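/- Infinite divisibility of the self-similar mass distribution for the additive kernel: For each ρ ∈ (0,1], let φ_ρ : (0,∞) → (0,∞) be defined implicitly by s = φ_ρ(s) + φ_ρ(s)^{1+ρ}, and let u_ρ(s) = (1 + (1+ρ) φ_ρ(s)^ρ)^{−1} (the Laplace transform of the probability distribution M_ρ). Then u_ρ = e^{−ψ_ρ} where ψ_ρ(s) = log(1 + (1+ρ)φ_ρ(s)^ρ) satisfies ψ_ρ(0⁺) = 0 and ψ_ρ′ is completely monotone on (0,∞); consequently the probability distribution M_ρ is infinitely divisible. -/

import Mathlib

/-!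
Infinite divisibility of the self-similar mass distribution M_ρ for
Smoluchowski's coagulation equation with additive kernel (Menon–Pego, Theorem 7.4).
-/

open MeasureTheory Filter Topology Set Real

noncomputable section

/-- Complete monotonicity of g on (0,∞):
g is infinitely differentiable with (−1)ⁿ g⁽ⁿ⁾ ≥ 0 on (0,∞). -/
def CompletelyMonotoneOn (g : ℝ → ℝ) : Prop :=
  (∀ n : ℕ, DifferentiableOn ℝ (iteratedDeriv n g) (Set.Ioi 0)) ∧
  (∀ n : ℕ, ∀ s : ℝ, 0 < s → 0 ≤ (-1 : ℝ) ^ n * iteratedDeriv n g s)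

/-- n-fold convolution power of a measure on ℝ (n = 0 gives δ₀). -/
def convPow (μ : Measure ℝ) : ℕ → Measure ℝ
  | 0 => Measure.dirac 0
  | n + 1 => (convPow μ n).conv μ

/-- A convenient form of complete monotonicity: an explicit sequence of signed derivatives. -/
def CMSeq (f : ℝ → ℝ) : Prop :=
  ∃ F : ℕ → ℝ → ℝ, (∀ s : ℝ, 0 < s → F 0 s = f s) ∧
    ∀ n : ℕ, ∀ s : ℝ, 0 < s → 0 ≤ F n s ∧ HasDerivAt (F n) (-(F (n + 1) s)) s

lemma CMSeq.congr {f g : ℝ → ℝ} (hf : CMSeq f) (h : ∀ s : ℝ, 0 < s → f s = g s) : CMSeq g := by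
  obtain ⟨F, h0, h1⟩ := hf
  exact ⟨F, fun s hs => (h0 s hs).trans (h s hs), h1⟩

lemma CMSeq.completelyMonotoneOn {g : ℝ → ℝ} (hg : CMSeq g) : CompletelyMonotoneOn g := by
  obtain ⟨F, h0, h1⟩ := hg
  have key : ∀ n : ℕ, ∀ s : ℝ, 0 < s → iteratedDeriv n g s = (-1) ^ n * F n s := by
    intro n
    induction n with
    | zero => intro s hs; simp [h0 s hs]
    | succ n ih =>
      intro s hs
      rw [iteratedDeriv_succ]
      have he : iteratedDeriv n g =ᶠ[𝓝 s] fun t => (-1) ^ n * F n t := by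
        filter_upwards [Ioi_mem_nhds hs] with t ht using ih t ht
      rw [he.deriv_eq, ((h1 n s hs).2.const_mul ((-1 : ℝ) ^ n)).deriv]
      ring
  refine ⟨fun n s hs => ?_, fun n s hs => ?_⟩
  · have he : iteratedDeriv n g =ᶠ[𝓝 s] fun t => (-1) ^ n * F n t := by
      filter_upwards [Ioi_mem_nhds hs] with t ht using key n t ht
    have := ((h1 n s hs).2.const_mul ((-1 : ℝ) ^ n)).differentiableAt
    exact (this.congr_of_eventuallyEq he).differentiableWithinAt
  · rw [key n s hs, ← mul_assoc, ← mul_pow]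
    simpa using (h1 n s hs).1

/-- Nonnegative combinations of powers of φ and of its derivative. -/
inductive KCls (ρ : ℝ) (φ : ℝ → ℝ) : (ℝ → ℝ) → Prop
  | term (c a k : ℝ) (hc : 0 ≤ c) (ha : 0 ≤ a) (hk : 0 ≤ k) :
      KCls ρ φ (fun s => c * φ s ^ (-a) * (1 + (1 + ρ) * φ s ^ ρ) ^ (-k))
  | add (f g : ℝ → ℝ) (hf : KCls ρ φ f) (hg : KCls ρ φ g) : KCls ρ φ (fun s => f s + g s)

section phi

variable {ρ : ℝ} {φ : ℝ → ℝ}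

lemma phi_lip (hρ : 0 < ρ) (hφ : ∀ s : ℝ, 0 < s → 0 < φ s ∧ s = φ s + φ s ^ (1 + ρ))
    {s t : ℝ} (hs : 0 < s) (ht : 0 < t) : |φ t - φ s| ≤ |t - s| := by
  have main : ∀ s t : ℝ, 0 < s → 0 < t → φ s ≤ φ t → φ t - φ s ≤ t - s := by
    intro s t hs ht h
    have h1 := (hφ s hs).2
    have h2 := (hφ t ht).2
    have h3 : φ s ^ (1 + ρ) ≤ φ t ^ (1 + ρ) :=
      Real.rpow_le_rpow (hφ s hs).1.le h (by linarith)
    linarith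
  rcases le_total (φ s) (φ t) with h | h
  · rw [abs_of_nonneg (by linarith)]
    exact (main s t hs ht h).trans (le_abs_self _)
  · rw [abs_sub_comm, abs_sub_comm t s, abs_of_nonneg (by linarith)]
    exact (main t s ht hs h).trans (le_abs_self _)

lemma phi_cont (hρ : 0 < ρ) (hφ : ∀ s : ℝ, 0 < s → 0 < φ s ∧ s = φ s + φ s ^ (1 + ρ))
    {s : ℝ} (hs : 0 < s) : ContinuousAt φ s := by
  rw [ContinuousAt, tendsto_iff_norm_sub_tendsto_zero]
  have h2 : Tendsto (fun t : ℝ => |t - s|) (𝓝 s) (𝓝 0) := by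
    have : Continuous (fun t : ℝ => |t - s|) := by fun_prop
    simpa using this.tendsto s
  refine squeeze_zero' (Eventually.of_forall fun t => norm_nonneg _) ?_ h2
  filter_upwards [Ioi_mem_nhds hs] with t ht
  exact phi_lip hρ hφ hs ht

lemma phi_base_pos (hρ : 0 < ρ) (hφ : ∀ s : ℝ, 0 < s → 0 < φ s ∧ s = φ s + φ s ^ (1 + ρ))
    {s : ℝ} (hs : 0 < s) : 0 < 1 + (1 + ρ) * φ s ^ ρ := by
  have := Real.rpow_pos_of_pos (hφ s hs).1 ρ
  positivity

lemma phi_deriv (hρ : 0 < ρ) (hφ : ∀ s : ℝ, 0 < s → 0 < φ s ∧ s = φ s + φ s ^ (1 + ρ))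
    {s : ℝ} (hs : 0 < s) : HasDerivAt φ (1 + (1 + ρ) * φ s ^ ρ)⁻¹ s := by
  refine HasDerivAt.of_local_left_inverse (f := fun x => x + x ^ (1 + ρ))
    (phi_cont hρ hφ hs) ?_ (phi_base_pos hρ hφ hs).ne' ?_
  · have h := (hasDerivAt_id' (φ s)).add
      (Real.hasDerivAt_rpow_const (x := φ s) (p := 1 + ρ) (Or.inl (hφ s hs).1.ne'))
    have e : 1 + ρ - 1 = ρ := by ring
    rw [e] at h
    exact h
  · filter_upwards [Ioi_mem_nhds hs] with t ht using (hφ t ht).2.symm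

lemma base_deriv (hρ : 0 < ρ) (hφ : ∀ s : ℝ, 0 < s → 0 < φ s ∧ s = φ s + φ s ^ (1 + ρ))
    {s : ℝ} (hs : 0 < s) : HasDerivAt (fun s => 1 + (1 + ρ) * φ s ^ ρ)
      ((1 + ρ) * ρ * φ s ^ (ρ - 1) * (1 + (1 + ρ) * φ s ^ ρ)⁻¹) s := by
  have h := (((phi_deriv hρ hφ hs).rpow_const (p := ρ)
    (Or.inl (hφ s hs).1.ne')).const_mul (1 + ρ)).const_add 1
  exact h.congr_deriv (by ring)

lemma KCls.nonneg (hρ : 0 < ρ) (hφ : ∀ s : ℝ, 0 < s → 0 < φ s ∧ s = φ s + φ s ^ (1 + ρ))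
    {f : ℝ → ℝ} (hf : KCls ρ φ f) {s : ℝ} (hs : 0 < s) : 0 ≤ f s := by
  induction hf with
  | term c a k hc ha hk =>
    have h1 := Real.rpow_pos_of_pos (hφ s hs).1 (-a)
    have h2 := Real.rpow_pos_of_pos (phi_base_pos hρ hφ hs) (-k)
    positivity
  | add f g _ _ h1 h2 => exact add_nonneg h1 h2

lemma KCls.deriv_mem (hρ : 0 < ρ) (hρ1 : ρ ≤ 1)
    (hφ : ∀ s : ℝ, 0 < s → 0 < φ s ∧ s = φ s + φ s ^ (1 + ρ))
    {f : ℝ → ℝ} (hf : KCls ρ φ f) :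
    ∃ g, KCls ρ φ g ∧ ∀ s : ℝ, 0 < s → HasDerivAt f (-(g s)) s := by
  induction hf with
  | term c a k hc ha hk =>
    refine ⟨_, KCls.add _ _
      (KCls.term (c * a) (a + 1) (k + 1) (by positivity) (by positivity) (by positivity))
      (KCls.term (c * k * ((1 + ρ) * ρ)) (a + (1 - ρ)) (k + 2) (by positivity)
        (by linarith) (by positivity)), fun s hs => ?_⟩
    have hp := (hφ s hs).1
    have hb := phi_base_pos hρ hφ hs
    have h := ((((phi_deriv hρ hφ hs).rpow_const (p := -a) (Or.inl hp.ne'))).const_mul c).mul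
      ((base_deriv hρ hφ hs).rpow_const (p := -k) (Or.inl hb.ne'))
    refine h.congr_deriv ?_
    set b := 1 + (1 + ρ) * φ s ^ ρ with hbdef
    have e1 : φ s ^ (-(a + 1)) = φ s ^ (-a - 1) := by congr 1; ring
    have e2 : b ^ (-(k + 1)) = b⁻¹ * b ^ (-k) := by
      rw [← Real.rpow_neg_one, ← Real.rpow_add hb]; congr 1; ring
    have e3 : b ^ (-(k + 2)) = b⁻¹ * b ^ (-k - 1) := by
      rw [← Real.rpow_neg_one, ← Real.rpow_add hb]; congr 1; ring
    have e4 : φ s ^ (-(a + (1 - ρ))) = φ s ^ (-a) * φ s ^ (ρ - 1) := by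
      rw [← Real.rpow_add hp]; congr 1; ring
    rw [e1, e2, e3, e4]
    ring
  | add f g _ _ h1 h2 =>
    obtain ⟨f', hf', hfd⟩ := h1
    obtain ⟨g', hg', hgd⟩ := h2
    refine ⟨_, KCls.add _ _ hf' hg', fun s hs => ?_⟩
    exact ((hfd s hs).add (hgd s hs)).congr_deriv (by ring)

lemma KCls.cmSeq (hρ : 0 < ρ) (hρ1 : ρ ≤ 1)
    (hφ : ∀ s : ℝ, 0 < s → 0 < φ s ∧ s = φ s + φ s ^ (1 + ρ))
    {f : ℝ → ℝ} (hf : KCls ρ φ f) : CMSeq f := by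
  have H : ∀ p : {f : ℝ → ℝ // KCls ρ φ f}, ∃ q : {f : ℝ → ℝ // KCls ρ φ f},
      ∀ s : ℝ, 0 < s → HasDerivAt p.1 (-(q.1 s)) s := fun p => by
    obtain ⟨g, hg, h⟩ := KCls.deriv_mem hρ hρ1 hφ p.2
    exact ⟨⟨g, hg⟩, h⟩
  choose D hD using H
  refine ⟨fun n => (D^[n] ⟨f, hf⟩).1, fun s _ => rfl, fun n s hs => ⟨?_, ?_⟩⟩
  · exact KCls.nonneg hρ hφ (D^[n] ⟨f, hf⟩).2 hs
  · have := hD (D^[n] ⟨f, hf⟩) s hs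
    simp only [Function.iterate_succ_apply']
    exact this

lemma phi_tendsto (hφ : ∀ s : ℝ, 0 < s → 0 < φ s ∧ s = φ s + φ s ^ (1 + ρ)) :
    Tendsto φ (𝓝[>] (0:ℝ)) (𝓝 0) := by
  have h2 : Tendsto (fun t : ℝ => t) (𝓝[>] (0:ℝ)) (𝓝 0) := tendsto_nhdsWithin_of_tendsto_nhds tendsto_id
  refine squeeze_zero' ?_ ?_ h2
  · filter_upwards [self_mem_nhdsWithin] with t ht using (hφ t ht).1.le
  · filter_upwards [self_mem_nhdsWithin] with t ht
    have := Real.rpow_pos_of_pos (hφ t ht).1 (1 + ρ)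
    linarith [(hφ t ht).2]

lemma base_tendsto (hρ : 0 < ρ) (hφ : ∀ s : ℝ, 0 < s → 0 < φ s ∧ s = φ s + φ s ^ (1 + ρ)) :
    Tendsto (fun s => 1 + (1 + ρ) * φ s ^ ρ) (𝓝[>] (0:ℝ)) (𝓝 1) := by
  have h := (((phi_tendsto hφ).rpow_const (p := ρ) (Or.inr hρ.le)).const_mul (1 + ρ)).const_add 1
  simpa [Real.zero_rpow hρ.ne'] using h

end phi

/-- The shift operator on sequences. -/
def shiftE : Module.End ℝ (ℕ → ℝ) := LinearMap.funLeft ℝ ℝ Nat.succ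

lemma shiftE_apply (a : ℕ → ℝ) (k : ℕ) : shiftE a k = a (k + 1) := rfl

lemma shiftE_pow_apply (i : ℕ) (a : ℕ → ℝ) (k : ℕ) : (shiftE ^ i) a k = a (k + i) := by
  induction i generalizing a with
  | zero => simp
  | succ i ih =>
    rw [pow_succ, Module.End.mul_apply, ih, shiftE_apply]
    rfl

lemma diff_binom (a : ℕ → ℝ) (M j : ℕ) :
    ∑ i ∈ Finset.range (M + 1), (M.choose i : ℝ) * ((1 - shiftE) ^ (M - i)) a (j + i) = a j := by
  have hc : Commute shiftE (1 - shiftE) := (Commute.one_right _).sub_right (Commute.refl _)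
  have h := hc.add_pow M
  have h1 : shiftE + (1 - shiftE) = 1 := by abel
  rw [h1, one_pow] at h
  have h2 := congrFun (LinearMap.congr_fun h a) j
  rw [LinearMap.sum_apply, Finset.sum_apply] at h2
  rw [Module.End.one_apply] at h2
  rw [h2]
  refine Finset.sum_congr rfl fun i _ => ?_
  rw [Module.End.mul_apply, Module.End.mul_apply, Module.End.natCast_apply]
  rw [map_nsmul, map_nsmul, Pi.smul_apply, nsmul_eq_mul, shiftE_pow_apply]

lemma shift_nonneg (m : ℕ) : ∀ f : ℝ → ℝ, CMSeq f → Tendsto f (𝓝[>] (0:ℝ)) (𝓝 (f 0)) →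
    ∀ k : ℕ, 0 ≤ ((1 - shiftE) ^ m) (fun i : ℕ => f i) k := by
  induction m with
  | zero =>
    intro f hf ht k
    simp only [pow_zero, Module.End.one_apply]
    obtain ⟨F, h0, h1⟩ := hf
    rcases Nat.eq_zero_or_pos k with rfl | hk
    · rw [Nat.cast_zero]
      refine ge_of_tendsto ht ?_
      filter_upwards [self_mem_nhdsWithin] with t ht
      rw [← h0 t ht]
      exact (h1 0 t ht).1
    · have : (0:ℝ) < k := by exact_mod_cast hk
      rw [← h0 _ this]
      exact (h1 0 _ this).1
  | succ m ih =>
    intro f hf ht k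
    have hT : ((1 - shiftE) : Module.End ℝ (ℕ → ℝ)) (fun i : ℕ => f i)
        = fun i : ℕ => (fun s : ℝ => f s - f (s + 1)) i := by
      funext i
      simp [shiftE_apply]
    rw [pow_succ, Module.End.mul_apply, hT]
    obtain ⟨F, h0, h1⟩ := hf
    refine ih (fun s : ℝ => f s - f (s + 1)) ⟨fun n s => F n s - F n (s + 1), ?_, ?_⟩ ?_ k
    · intro s hs
      simp only [h0 s hs, h0 (s + 1) (by linarith)]
    · intro n s hs
      constructor
      · have hanti : AntitoneOn (F n) (Ioi 0) := by
          refine antitoneOn_of_deriv_nonpos (convex_Ioi 0) ?_ ?_ ?_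
          · exact fun x hx => (h1 n x hx).2.continuousAt.continuousWithinAt
          · rw [interior_Ioi]
            exact fun x hx => (h1 n x hx).2.differentiableAt.differentiableWithinAt
          · rw [interior_Ioi]
            intro x hx
            rw [(h1 n x hx).2.deriv]
            linarith [(h1 (n + 1) x hx).1]
        have := hanti (show s ∈ Ioi (0:ℝ) from hs) (show s + 1 ∈ Ioi (0:ℝ) by
          simp only [mem_Ioi]; linarith) (by linarith)
        linarith
      · have hb : HasDerivAt (fun s => F n (s + 1)) (-(F (n + 1) (s + 1))) s :=
          HasDerivAt.comp_add_const s 1 (h1 n (s + 1) (by linarith)).2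
        exact ((h1 n s hs).2.sub hb).congr_deriv (by ring)
    · refine ht.sub ?_
      have hc : ContinuousAt f (0 + 1) := by
        have h2 : F 0 =ᶠ[𝓝 (0 + 1 : ℝ)] f := by
          filter_upwards [Ioi_mem_nhds (show (0:ℝ) < 0 + 1 by norm_num)] with t ht using h0 t ht
        exact (h1 0 (0 + 1) (by norm_num)).2.continuousAt.congr h2
      have h3 : Tendsto (fun s : ℝ => s + 1) (𝓝 0) (𝓝 (0 + 1)) := by
        have : Continuous (fun s : ℝ => s + 1) := by fun_prop
        exact this.tendsto 0
      exact (hc.tendsto.comp h3).mono_left nhdsWithin_le_nhds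

/-- The weights of the discrete approximation in the Hausdorff moment problem. -/
def hw (a : ℕ → ℝ) (N k : ℕ) : ℝ := (N.choose k : ℝ) * ((1 - shiftE) ^ (N - k)) a k

lemma hw_sum (a : ℕ → ℝ) (N j : ℕ) (h : j ≤ N) :
    ∑ k ∈ Finset.range (N + 1), hw a N k * ((k.choose j : ℝ) / (N.choose j : ℝ)) = a j := by
  obtain ⟨M, rfl⟩ := Nat.exists_eq_add_of_le h
  rw [add_assoc, Finset.sum_range_add, Finset.sum_eq_zero, zero_add, ← diff_binom a M j]
  · refine Finset.sum_congr rfl fun i hi => ?_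
    have hi' : i ≤ M := by simpa [Nat.lt_succ_iff] using hi
    have h1 := Nat.choose_mul (n := j + M) (k := j + i) (s := j) (by omega)
    have e1 : j + M - j = M := by omega
    have e2 : j + i - j = i := by omega
    have e3 : j + M - (j + i) = M - i := by omega
    rw [e1, e2] at h1
    have h2 : ((j + M).choose (j + i) : ℝ) * ((j + i).choose j : ℝ)
      = ((j + M).choose j : ℝ) * (M.choose i : ℝ) := by exact_mod_cast h1
    have h3 : ((j + M).choose j : ℝ) ≠ 0 := by
      exact_mod_cast (Nat.choose_pos (by omega)).ne'
    rw [hw, e3]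
    field_simp
    linear_combination ((1 - shiftE) ^ (M - i)) a (j + i) * h2
  · intro k hk
    rw [Nat.choose_eq_zero_of_lt (Finset.mem_range.1 hk)]
    simp

lemma choose_ratio_bound (N k : ℕ) (hk : k ≤ N) (hN : 0 < N) (j : ℕ) (hj : j ≤ N) :
    |((k:ℝ) / N) ^ j - (k.choose j : ℝ) / (N.choose j : ℝ)| ≤ (j:ℝ) * j / N := by
  have hN' : (0:ℝ) < N := by exact_mod_cast hN
  have hr : ∀ i, 0 ≤ (k.choose i : ℝ) / (N.choose i : ℝ) ∧
      (k.choose i : ℝ) / (N.choose i : ℝ) ≤ 1 := fun i => by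
    refine ⟨by positivity, div_le_one_of_le₀ ?_ (by positivity)⟩
    exact_mod_cast Nat.choose_le_choose i hk
  have hy0 : 0 ≤ (k:ℝ) / N := by positivity
  have hy1 : (k:ℝ) / N ≤ 1 := div_le_one_of_le₀ (by exact_mod_cast hk) (by positivity)
  induction j with
  | zero => simp
  | succ j ih =>
    have ih' := ih (by omega)
    have hc : ∀ n : ℕ, (n.choose (j + 1) : ℝ) * (j + 1) = n.choose j * ((n:ℝ) - j) := by
      intro n
      rcases le_or_gt j n with h | h
      · have := Nat.choose_succ_right_eq n j
        rw [← Nat.cast_sub h]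
        exact_mod_cast this
      · rw [Nat.choose_eq_zero_of_lt h, Nat.choose_eq_zero_of_lt (by omega)]
        simp
    have hjN : (j:ℝ) < N := by exact_mod_cast (show j < N by omega)
    have hp1 : (0:ℝ) < (N.choose j : ℝ) := by exact_mod_cast Nat.choose_pos (by omega)
    have hp2 : (0:ℝ) < (N.choose (j + 1) : ℝ) := by exact_mod_cast Nat.choose_pos (by omega)
    have hrec : (k.choose (j + 1) : ℝ) / (N.choose (j + 1) : ℝ) * (N - j)
        = (k.choose j : ℝ) / (N.choose j : ℝ) * (k - j) := by
      rw [div_mul_eq_mul_div, div_mul_eq_mul_div, div_eq_div_iff hp2.ne' hp1.ne']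
      have a1 := hc N
      have a2 := hc k
      have h3 : (0:ℝ) < (j:ℝ) + 1 := by positivity
      apply mul_left_cancel₀ h3.ne'
      linear_combination (k.choose (j+1) : ℝ) * (-(j + 1 : ℝ)) * a1 + (N.choose (j + 1) : ℝ) * (j + 1) * a2
    set r := (k.choose j : ℝ) / (N.choose j : ℝ) with hrd
    set r' := (k.choose (j + 1) : ℝ) / (N.choose (j + 1) : ℝ) with hrd'
    set y := (k:ℝ) / N with hyd
    have hyk : y * N = k := by rw [hyd]; field_simp
    have e : y ^ (j + 1) - r' = y * (y ^ j - r) + (j / N) * (r - r') := by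
      have : y * r - r' = (j / N) * (r - r') := by
        field_simp
        linear_combination r * hyk - hrec
      rw [pow_succ]
      linear_combination this
    rw [e]
    have hb1 : |y * (y ^ j - r)| ≤ (j:ℝ) * j / N := by
      rw [abs_mul, abs_of_nonneg hy0]
      calc y * |y ^ j - r| ≤ 1 * |y ^ j - r| := by gcongr
        _ ≤ _ := by simpa using ih'
    have hb2 : |((j:ℝ) / N) * (r - r')| ≤ j / N := by
      rw [abs_mul, abs_of_nonneg (by positivity)]
      have : |r - r'| ≤ 1 := by
        have h1 := hr j; have h2 := hr (j + 1)
        rw [abs_le]; constructor <;> linarith [h1.1, h1.2, h2.1, h2.2]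
      calc (j:ℝ) / N * |r - r'| ≤ j / N * 1 := by gcongr
        _ = _ := mul_one _
    calc _ ≤ _ := abs_add_le _ _
      _ ≤ (j:ℝ) * j / N + j / N := add_le_add hb1 hb2
      _ ≤ _ := by
        rw [← add_div]
        gcongr
        push_cast
        nlinarith [(Nat.cast_nonneg j : (0:ℝ) ≤ j)]

/-- The point `k / N` of the unit interval. -/
def hpt (N k : ℕ) : unitInterval := Set.projIcc 0 1 zero_le_one ((k:ℝ) / N)

lemma hpt_coe (N k : ℕ) (hk : k ≤ N) : ((hpt N k : unitInterval) : ℝ) = (k:ℝ) / N := by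
  rw [hpt, Set.projIcc_of_mem zero_le_one (x := (k:ℝ) / N)]
  exact ⟨by positivity, div_le_one_of_le₀ (by exact_mod_cast hk) (by positivity)⟩

/-- The discrete approximating measures. -/
def hmeas (a : ℕ → ℝ) (N : ℕ) : Measure unitInterval :=
  ∑ k ∈ Finset.range (N + 1), ENNReal.ofReal (hw a N k) • Measure.dirac (hpt N k)

lemma hw_nonneg {a : ℕ → ℝ} (ha : ∀ m k : ℕ, 0 ≤ ((1 - shiftE) ^ m) a k) (N k : ℕ) :
    0 ≤ hw a N k := mul_nonneg (by positivity) (ha _ _)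

lemma hmeas_prob {a : ℕ → ℝ} (ha : ∀ m k : ℕ, 0 ≤ ((1 - shiftE) ^ m) a k) (h0 : a 0 = 1)
    (N : ℕ) : IsProbabilityMeasure (hmeas a N) := by
  constructor
  have h := hw_sum a N 0 (Nat.zero_le _)
  simp only [Nat.choose_zero_right, Nat.cast_one, div_one, mul_one, h0] at h
  simp only [hmeas, Measure.coe_finsetSum, Finset.sum_apply, Measure.smul_apply, measure_univ,
    smul_eq_mul, mul_one]
  rw [← ENNReal.ofReal_sum_of_nonneg (fun k _ => hw_nonneg ha N k), h, ENNReal.ofReal_one]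

lemma hmeas_integral {a : ℕ → ℝ} (ha : ∀ m k : ℕ, 0 ≤ ((1 - shiftE) ^ m) a k)
    (N j : ℕ) : ∫ y, (y:ℝ) ^ j ∂(hmeas a N)
      = ∑ k ∈ Finset.range (N + 1), hw a N k * ((k:ℝ) / N) ^ j := by
  rw [hmeas, integral_finsetSum_measure]
  · refine Finset.sum_congr rfl fun k hk => ?_
    rw [integral_smul_measure, integral_dirac, ENNReal.toReal_ofReal (hw_nonneg ha N k),
      hpt_coe N k (by simpa [Nat.lt_succ_iff] using hk), smul_eq_mul]
  · intro k _
    exact (integrable_dirac (by simp)).smul_measure ENNReal.ofReal_ne_top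

lemma hausdorff_moment {a : ℕ → ℝ} (ha : ∀ m k : ℕ, 0 ≤ ((1 - shiftE) ^ m) a k) (h0 : a 0 = 1) :
    ∃ ν : Measure unitInterval, IsProbabilityMeasure ν ∧ ∀ j : ℕ, ∫ y, (y:ℝ) ^ j ∂ν = a j := by
  let P : ℕ → ProbabilityMeasure unitInterval := fun N => ⟨hmeas a N, hmeas_prob ha h0 N⟩
  obtain ⟨ν, -, hν⟩ := isCompact_univ.ultrafilter_le_nhds
    ((hyperfilter ℕ).map P) (by simp)
  have ht : Tendsto P (hyperfilter ℕ : Filter ℕ) (𝓝 ν) := hν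
  rw [ProbabilityMeasure.tendsto_iff_forall_integral_tendsto] at ht
  refine ⟨ν, inferInstance, fun j => ?_⟩
  have h1 := ht (BoundedContinuousFunction.mkOfCompact ⟨fun y : unitInterval => (y:ℝ) ^ j, by fun_prop⟩)
  simp only [BoundedContinuousFunction.mkOfCompact_apply, ContinuousMap.coe_mk] at h1
  have h2 : Tendsto (fun N => ∫ y, (y:ℝ) ^ j ∂(P N : Measure unitInterval)) atTop (𝓝 (a j)) := by
    rw [tendsto_iff_norm_sub_tendsto_zero]
    refine squeeze_zero' (Eventually.of_forall fun t => norm_nonneg _) ?_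
      (tendsto_const_div_atTop_nhds_zero_nat ((j:ℝ) * j))
    filter_upwards [eventually_ge_atTop (j + 1)] with N hN
    change ‖∫ y, (y:ℝ) ^ j ∂(hmeas a N) - a j‖ ≤ _
    rw [hmeas_integral ha, ← hw_sum a N j (by omega), ← Finset.sum_sub_distrib, Real.norm_eq_abs]
    have hs := hw_sum a N 0 (Nat.zero_le _)
    simp only [Nat.choose_zero_right, Nat.cast_one, div_one, mul_one, h0] at hs
    calc _ ≤ _ := Finset.abs_sum_le_sum_abs _ _
      _ ≤ ∑ k ∈ Finset.range (N + 1), hw a N k * ((j:ℝ) * j / N) := by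
        refine Finset.sum_le_sum fun k hk => ?_
        rw [← mul_sub, abs_mul, abs_of_nonneg (hw_nonneg ha N k)]
        exact mul_le_mul_of_nonneg_left (choose_ratio_bound N k
          (by simpa [Nat.lt_succ_iff] using hk) (by omega) j (by omega)) (hw_nonneg ha N k)
      _ = _ := by rw [← Finset.sum_mul, hs, one_mul]
  exact tendsto_nhds_unique h1 (h2.mono_left Nat.hyperfilter_le_atTop)

lemma moment_unique {P Q : Measure unitInterval} [IsProbabilityMeasure P] [IsProbabilityMeasure Q]
    (h : ∀ j : ℕ, ∫ y, (y:ℝ) ^ j ∂P = ∫ y, (y:ℝ) ^ j ∂Q) : P = Q := by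
  have hint : ∀ (κ : Measure unitInterval) [IsProbabilityMeasure κ] (g : unitInterval → ℝ),
      Continuous g → Integrable g κ := fun κ _ g hg =>
    (BoundedContinuousFunction.mkOfCompact ⟨g, hg⟩).integrable κ
  have hpoly : ∀ p : Polynomial ℝ, ∫ y : unitInterval, p.eval (y:ℝ) ∂P
      = ∫ y : unitInterval, p.eval (y:ℝ) ∂Q := by
    intro p
    simp only [Polynomial.eval_eq_sum_range]
    rw [integral_finsetSum _ fun i _ => hint P _ (by fun_prop),
      integral_finsetSum _ fun i _ => hint Q _ (by fun_prop)]
    refine Finset.sum_congr rfl fun i _ => ?_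
    rw [integral_const_mul, integral_const_mul, h i]
  apply ext_of_forall_integral_eq_of_IsFiniteMeasure
  intro f
  have key : ∀ ε : ℝ, 0 < ε → |∫ y, f y ∂P - ∫ y, f y ∂Q| ≤ 2 * ε := by
    intro ε hε
    obtain ⟨p, hp⟩ := exists_polynomial_near_continuousMap 0 1 f.toContinuousMap ε hε
    have hp' : ∀ y : unitInterval, ‖f y - p.eval (y:ℝ)‖ ≤ ε := by
      intro y
      have := ContinuousMap.norm_coe_le_norm (p.toContinuousMapOn (Icc 0 1) - f.toContinuousMap) y
      have h2 := this.trans hp.le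
      rw [norm_sub_rev]
      exact h2
    have hR : ∀ (κ : Measure unitInterval) [IsProbabilityMeasure κ],
        |∫ y, f y ∂κ - ∫ y : unitInterval, p.eval (y:ℝ) ∂κ| ≤ ε := by
      intro κ _
      rw [← integral_sub (f.integrable κ) (hint κ _ (by fun_prop)), ← Real.norm_eq_abs]
      refine (norm_integral_le_of_norm_le_const (C := ε) (Eventually.of_forall hp')).trans ?_
      simp
    have h1 := hR P
    have h2 := hR Q
    rw [hpoly p] at h1
    rw [abs_le] at *
    constructor <;> linarith [h1.1, h1.2, h2.1, h2.2]
  have : |∫ y, f y ∂P - ∫ y, f y ∂Q| ≤ 0 := by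
    refine le_of_forall_pos_le_add fun ε hε => ?_
    have := key (ε / 2) (by positivity)
    linarith
  exact sub_eq_zero.1 (abs_nonpos_iff.1 this)

/-- `x ↦ exp (-x)` as a map to the unit interval. -/
def eMap (x : ℝ) : unitInterval := Set.projIcc 0 1 zero_le_one (Real.exp (-x))

lemma eMap_meas : Measurable eMap := by
  have : Continuous eMap := continuous_projIcc.comp (by fun_prop)
  exact this.measurable

lemma eMap_coe {x : ℝ} (hx : 0 ≤ x) : ((eMap x : unitInterval) : ℝ) = Real.exp (-x) := by
  rw [eMap, Set.projIcc_of_mem zero_le_one (x := Real.exp (-x))]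
  exact ⟨by positivity, by simpa using hx⟩

/-- The left inverse of `eMap`. -/
def lMap (y : unitInterval) : ℝ := -Real.log (y:ℝ)

lemma lMap_meas : Measurable lMap := by
  unfold lMap; fun_prop

lemma lMap_nonneg (y : unitInterval) : 0 ≤ lMap y := by
  have := Real.log_nonpos y.2.1 y.2.2
  unfold lMap; linarith

lemma ae_nonneg_of {m : Measure ℝ} (h : m (Iio 0) = 0) : ∀ᵐ x ∂m, 0 ≤ x := by
  rw [ae_iff]
  convert h using 2
  ext x; simp

lemma eMap_moment {m : Measure ℝ} (h : m (Iio 0) = 0) (j : ℕ) :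
    ∫ y, (y:ℝ) ^ j ∂(m.map eMap) = ∫ x, Real.exp (-((j:ℝ) * x)) ∂m := by
  rw [integral_map eMap_meas.aemeasurable (by fun_prop)]
  refine integral_congr_ae ?_
  filter_upwards [ae_nonneg_of h] with x hx
  rw [eMap_coe hx, ← Real.exp_nat_mul]
  congr 1; ring

lemma map_lMap_eMap {m : Measure ℝ} (h : m (Iio 0) = 0) : (m.map eMap).map lMap = m := by
  rw [Measure.map_map lMap_meas eMap_meas]
  conv_rhs => rw [← Measure.map_id (μ := m)]
  refine Measure.map_congr ?_
  filter_upwards [ae_nonneg_of h] with x hx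
  simp [lMap, eMap_coe hx]

lemma laplace_unique {m mm : Measure ℝ} [IsProbabilityMeasure m] [IsProbabilityMeasure mm]
    (h : m (Iio 0) = 0) (hnull : mm (Iio 0) = 0)
    (hL : ∀ j : ℕ, 0 < j → ∫ x, Real.exp (-((j:ℝ) * x)) ∂m = ∫ x, Real.exp (-((j:ℝ) * x)) ∂mm) :
    m = mm := by
  have : IsProbabilityMeasure (m.map eMap) := Measure.isProbabilityMeasure_map eMap_meas.aemeasurable
  have : IsProbabilityMeasure (mm.map eMap) := Measure.isProbabilityMeasure_map eMap_meas.aemeasurable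
  have e : m.map eMap = mm.map eMap := moment_unique fun j => by
    rw [eMap_moment h, eMap_moment hnull]
    rcases Nat.eq_zero_or_pos j with rfl | hj
    · simp
    · exact hL j hj
  rw [← map_lMap_eMap h, e, map_lMap_eMap hnull]

/-- Multiplicative convolution powers on the unit interval. -/
def mPow (ν : Measure unitInterval) : ℕ → Measure unitInterval
  | 0 => Measure.dirac 1
  | n + 1 => (mPow ν n).mconv ν

lemma mPow_prob (ν : Measure unitInterval) [IsProbabilityMeasure ν] (n : ℕ) :
    IsProbabilityMeasure (mPow ν n) := by
  induction n with
  | zero => rw [mPow]; infer_instance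
  | succ n ih => rw [mPow]; infer_instance

lemma mPow_moment (ν : Measure unitInterval) [IsProbabilityMeasure ν] (n j : ℕ) :
    ∫ y, (y:ℝ) ^ j ∂(mPow ν n) = (∫ y, (y:ℝ) ^ j ∂ν) ^ n := by
  induction n with
  | zero => simp [mPow]
  | succ n ih =>
    have := mPow_prob ν n
    rw [mPow, integral_mconv]
    · simp only [Set.Icc.coe_mul, mul_pow, integral_const_mul, integral_mul_const]
      rw [ih, pow_succ]
    · exact (BoundedContinuousFunction.mkOfCompact
        ⟨fun y : unitInterval => (y:ℝ) ^ j, by fun_prop⟩).integrable _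

lemma mPow_zero_le (ν : Measure unitInterval) [IsProbabilityMeasure ν] (n : ℕ) :
    ν {0} ≤ mPow ν (n + 1) {0} := by
  have := mPow_prob ν n
  rw [mPow, Measure.mconv, Measure.map_apply (by fun_prop) (measurableSet_singleton _)]
  calc ν {0} = (mPow ν n).prod ν (univ ×ˢ {0}) := by simp [Measure.prod_prod]
    _ ≤ _ := measure_mono (by rintro ⟨x, y⟩ h; simp at h; simp [h])

lemma convPow_prob (ν : Measure ℝ) [IsProbabilityMeasure ν] (n : ℕ) :
    IsProbabilityMeasure (convPow ν n) := by
  induction n with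
  | zero => rw [convPow]; infer_instance
  | succ n ih => rw [convPow]; infer_instance

lemma convPow_null (ν : Measure ℝ) [IsProbabilityMeasure ν] (h : ν (Iio 0) = 0) (n : ℕ) :
    convPow ν n (Iio 0) = 0 := by
  induction n with
  | zero => simp [convPow]
  | succ n ih =>
    have := convPow_prob ν n
    rw [convPow, Measure.conv, Measure.map_apply (by fun_prop) measurableSet_Iio]
    refine measure_mono_null (t := (Iio 0 ×ˢ univ) ∪ (univ ×ˢ Iio 0)) ?_ ?_
    · rintro ⟨x, y⟩ hxy
      simp only [mem_preimage, mem_Iio] at hxy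
      simp only [mem_union, mem_prod, mem_Iio, mem_univ, and_true, true_and]
      by_contra! hc
      linarith [hc.1, hc.2]
    · rw [measure_union_null_iff, Measure.prod_prod, Measure.prod_prod, ih, h]
      simp

lemma exp_integrable {m : Measure ℝ} [IsProbabilityMeasure m] (h : m (Iio 0) = 0) (j : ℕ) :
    Integrable (fun x : ℝ => Real.exp (-((j:ℝ) * x))) m := by
  refine Integrable.of_bound (C := 1) (by fun_prop) ?_
  filter_upwards [ae_nonneg_of h] with x hx
  rw [Real.norm_eq_abs, abs_of_pos (Real.exp_pos _), Real.exp_le_one_iff]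
  have : 0 ≤ (j:ℝ) * x := by positivity
  linarith

lemma convPow_laplace (ν : Measure ℝ) [IsProbabilityMeasure ν] (h : ν (Iio 0) = 0) (n j : ℕ) :
    ∫ x, Real.exp (-((j:ℝ) * x)) ∂(convPow ν n) = (∫ x, Real.exp (-((j:ℝ) * x)) ∂ν) ^ n := by
  induction n with
  | zero => simp [convPow]
  | succ n ih =>
    have := convPow_prob ν n
    have := convPow_prob ν (n + 1)
    have hi := exp_integrable (convPow_null ν h (n + 1)) j
    rw [convPow] at hi ⊢
    rw [integral_conv hi]
    simp only [mul_add, neg_add, Real.exp_add, integral_const_mul, integral_mul_const]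
    rw [ih, pow_succ]

lemma exists_root {a : ℕ → ℝ} (ha : ∀ m k : ℕ, 0 ≤ ((1 - shiftE) ^ m) a k) (h0 : a 0 = 1)
    (μ : Measure ℝ) [IsProbabilityMeasure μ] (hμ : μ (Iio 0) = 0) (n : ℕ) (hn : 0 < n)
    (hL : ∀ j : ℕ, 0 < j → ∫ x, Real.exp (-((j:ℝ) * x)) ∂μ = a j ^ n) :
    ∃ μn : Measure ℝ, IsProbabilityMeasure μn ∧ convPow μn n = μ := by
  obtain ⟨ν, hν, hm⟩ := hausdorff_moment ha h0
  have := mPow_prob ν n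
  have : IsProbabilityMeasure (μ.map eMap) := Measure.isProbabilityMeasure_map eMap_meas.aemeasurable
  have e : mPow ν n = μ.map eMap := moment_unique fun j => by
    rw [mPow_moment, eMap_moment hμ, hm]
    rcases Nat.eq_zero_or_pos j with rfl | hj
    · simp [h0]
    · exact (hL j hj).symm
  have hz : ν {0} = 0 := by
    obtain ⟨k, rfl⟩ : ∃ k, n = k + 1 := ⟨n - 1, by omega⟩
    refine le_antisymm ((mPow_zero_le ν k).trans ?_) bot_le
    rw [e, Measure.map_apply eMap_meas (measurableSet_singleton _)]
    refine (measure_mono_null (t := Iio 0) ?_ hμ).le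
    intro x hx
    by_contra hc
    have hc' : 0 ≤ x := by simpa using hc
    have h1 : eMap x = 0 := hx
    have h2 := eMap_coe hc'
    rw [h1] at h2
    exact (Real.exp_pos (-x)).ne h2
  have hp : IsProbabilityMeasure (ν.map lMap) :=
    Measure.isProbabilityMeasure_map lMap_meas.aemeasurable
  have hnull : (ν.map lMap) (Iio 0) = 0 := by
    rw [Measure.map_apply lMap_meas measurableSet_Iio]
    convert measure_empty (μ := ν)
    ext y
    simpa using lMap_nonneg y
  refine ⟨ν.map lMap, hp, ?_⟩
  have := convPow_prob (ν.map lMap) n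
  refine laplace_unique (convPow_null _ hnull n) hμ fun j hj => ?_
  rw [convPow_laplace _ hnull, hL j hj, ← hm j]
  congr 1
  rw [integral_map lMap_meas.aemeasurable (by fun_prop)]
  refine integral_congr_ae ?_
  have hae : ∀ᵐ y ∂ν, y ≠ 0 := by
    rw [ae_iff]; simpa using hz
  filter_upwards [hae] with y hy
  have hy' : 0 < (y:ℝ) := lt_of_le_of_ne y.2.1 (fun hh => hy (Subtype.ext hh.symm))
  rw [lMap, mul_neg, neg_neg, Real.exp_nat_mul, Real.exp_log hy']

theorem add_selfSimilar_infinitely_divisible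
    (ρ : ℝ) (hρ : ρ ∈ Set.Ioc (0:ℝ) 1)
    -- φ_ρ : (0,∞) → (0,∞) defined implicitly by s = φ_ρ(s) + φ_ρ(s)^{1+ρ}
    (φρ : ℝ → ℝ)
    (hφρ : ∀ s : ℝ, 0 < s → 0 < φρ s ∧ s = φρ s + φρ s ^ (1 + ρ))
    -- u_ρ = (1 + (1+ρ) φ_ρ^ρ)⁻¹, the Laplace transform of M_ρ
    (uρ : ℝ → ℝ) (huρ : ∀ s : ℝ, 0 < s → uρ s = (1 + (1 + ρ) * φρ s ^ ρ)⁻¹)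
    -- ψ_ρ = log(1 + (1+ρ) φ_ρ^ρ)
    (ψρ : ℝ → ℝ) (hψρ : ∀ s : ℝ, 0 < s → ψρ s = Real.log (1 + (1 + ρ) * φρ s ^ ρ)) :
    -- u_ρ = e^{−ψ_ρ}
    (∀ s : ℝ, 0 < s → uρ s = Real.exp (-(ψρ s))) ∧
    -- ψ_ρ(0⁺) = 0
    Tendsto ψρ (𝓝[>] (0:ℝ)) (𝓝 0) ∧
    -- ψ_ρ′ is completely monotone on (0,∞)
    CompletelyMonotoneOn (deriv ψρ) ∧
    -- consequently, M_ρ (the probability measure with Laplace transform u_ρ)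
    -- is infinitely divisible
    (∀ μ : Measure ℝ, IsProbabilityMeasure μ → μ (Set.Iio 0) = 0 →
      (∀ s : ℝ, 0 < s → ∫ x, Real.exp (-(s * x)) ∂μ = uρ s) →
      ∀ n : ℕ, 0 < n → ∃ μn : Measure ℝ, IsProbabilityMeasure μn ∧ convPow μn n = μ) := by
  obtain ⟨hρ0, hρ1⟩ := hρ
  have hexp : ∀ s : ℝ, 0 < s → uρ s = Real.exp (-(ψρ s)) := fun s hs => by
    rw [huρ s hs, hψρ s hs, Real.exp_neg, Real.exp_log (phi_base_pos hρ0 hφρ hs)]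
  refine ⟨hexp, ?_, ?_, ?_⟩
  · have h := (Real.continuousAt_log one_ne_zero).tendsto.comp (base_tendsto hρ0 hφρ)
    rw [Real.log_one] at h
    refine h.congr' ?_
    filter_upwards [self_mem_nhdsWithin] with s hs using (hψρ s hs).symm
  · refine CMSeq.completelyMonotoneOn ((KCls.cmSeq hρ0 hρ1 hφρ
      (KCls.term ((1 + ρ) * ρ) (1 - ρ) 2 (by positivity) (by linarith) (by norm_num))).congr ?_)
    intro s hs
    have he : ψρ =ᶠ[𝓝 s] fun t => Real.log (1 + (1 + ρ) * φρ t ^ ρ) := by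
      filter_upwards [Ioi_mem_nhds hs] with t ht using hψρ t ht
    have hb := phi_base_pos hρ0 hφρ hs
    rw [he.deriv_eq, ((base_deriv hρ0 hφρ hs).log hb.ne').deriv, neg_sub, Real.rpow_neg hb.le,
      Real.rpow_two]
    field_simp
  · intro μ hμ hμ0 hL n hn
    have hn' : (0:ℝ) < n := by exact_mod_cast hn
    let f : ℝ → ℝ := fun s => if 0 < s then (1 + (1 + ρ) * φρ s ^ ρ) ^ (-(1 / (n:ℝ))) else 1
    have hf0 : f 0 = 1 := by simp [f]
    have hf1 : ∀ s : ℝ, 0 < s → f s = (1 + (1 + ρ) * φρ s ^ ρ) ^ (-(1 / (n:ℝ))) :=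
      fun s hs => by simp only [f, if_pos hs]
    have hcm : CMSeq f := (KCls.cmSeq hρ0 hρ1 hφρ
      (KCls.term 1 0 (1 / n) (by norm_num) (by norm_num) (by positivity))).congr fun s hs => by
        rw [hf1 s hs]; simp
    have hlim : Tendsto f (𝓝[>] (0:ℝ)) (𝓝 (f 0)) := by
      have h := (base_tendsto hρ0 hφρ).rpow_const (p := -(1 / (n:ℝ))) (Or.inl one_ne_zero)
      rw [Real.one_rpow] at h
      rw [hf0]
      refine h.congr' ?_
      filter_upwards [self_mem_nhdsWithin] with s hs using (hf1 s hs).symm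
    refine exists_root (a := fun k : ℕ => f k) (fun m k => shift_nonneg m f hcm hlim k)
      (by simpa using hf0) μ hμ0 n hn fun j hj => ?_
    have hj' : (0:ℝ) < j := by exact_mod_cast hj
    have hb := phi_base_pos hρ0 hφρ hj'
    rw [hL j hj', huρ j hj', hf1 j hj', ← Real.rpow_natCast, ← Real.rpow_mul hb.le,
      ← Real.rpow_neg_one]
    congr 1
    field_simp
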